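/- Let ρ be the higher-order GSOS law induced by a relatively flat higher-order GSOS law, let z : Z → B(Z,Z) be a locally final coalgebra for B, and assume B(μΣ,−) has a final coalgebra. Then there exists a Σ-algebra structure a_ρ : ΣZ → Z making (Z, a_ρ, z) a ρ-bialgebra, and the Σ-algebra (Z, a_ρ) is computationally adequate. -/

import Mathlib

open CategoryTheory CategoryTheory.Limits Opposite

universe w v u

/-- A free `S`-algebra on an object `X` (providing the object `S*X` of the free monad). -/
structure FreeAlg {C : Type u} [Category.{v} C] (S : C ⥤ C) (X : C) where
  carrier : C
  emb : X ⟶ carrier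
  act : S.obj carrier ⟶ carrier
  desc : ∀ {A : C}, (S.obj A ⟶ A) → (X ⟶ A) → (carrier ⟶ A)
  emb_desc : ∀ {A : C} (a : S.obj A ⟶ A) (h : X ⟶ A), emb ≫ desc a h = h
  act_desc : ∀ {A : C} (a : S.obj A ⟶ A) (h : X ⟶ A),
    act ≫ desc a h = S.map (desc a h) ≫ a
  desc_unique : ∀ {A : C} (a : S.obj A ⟶ A) (h : X ⟶ A) (k : carrier ⟶ A),
    emb ≫ k = h → act ≫ k = S.map k ≫ a → k = desc a h

variable {C : Type u} [Category.{v} C] [HasBinaryProducts C] [HasBinaryCoproducts C]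

/-- The action of the free monad `S*` on a morphism. -/
def freeMap {S : C ⥤ C} (F : ∀ X : C, FreeAlg S X) {X Y : C} (f : X ⟶ Y) :
    (F X).carrier ⟶ (F Y).carrier :=
  (F X).desc (F Y).act (f ≫ (F Y).emb)

/-- A decomposition of `S` as a `J`-indexed coproduct `S = ∐_j S_j` of endofunctors
(coproducts of functors are computed pointwise). -/
structure Decomp (S : C ⥤ C) (J : Type w) where
  part : J → C ⥤ C
  inj : ∀ j : J, part j ⟶ S
  cdesc : ∀ (W : C) {T : C}, (∀ j : J, (part j).obj W ⟶ T) → (S.obj W ⟶ T)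
  inj_cdesc : ∀ (W : C) {T : C} (f : ∀ j : J, (part j).obj W ⟶ T) (j : J),
    (inj j).app W ≫ cdesc W f = f j
  cdesc_unique : ∀ (W : C) {T : C} (f : ∀ j : J, (part j).obj W ⟶ T) (k : S.obj W ⟶ T),
    (∀ j : J, (inj j).app W ≫ k = f j) → k = cdesc W f

/-- For each `j`, the functor `S_{<j} = ∐_{i<j} S_i`, again a pointwise coproduct. -/
structure LtDecomp {S : C ⥤ C} {J : Type w} (r : J → J → Prop) (D : Decomp S J) where
  functor : J → C ⥤ C
  inj : ∀ {i j : J}, r i j → (D.part i ⟶ functor j)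
  cdesc : ∀ (j : J) (W : C) {T : C},
    (∀ i : J, r i j → ((D.part i).obj W ⟶ T)) → ((functor j).obj W ⟶ T)
  inj_cdesc : ∀ (j : J) (W : C) {T : C} (f : ∀ i : J, r i j → ((D.part i).obj W ⟶ T))
    (i : J) (hij : r i j), (inj hij).app W ≫ cdesc j W f = f i hij
  cdesc_unique : ∀ (j : J) (W : C) {T : C} (f : ∀ i : J, r i j → ((D.part i).obj W ⟶ T))
    (k : (functor j).obj W ⟶ T),
    (∀ (i : J) (hij : r i j), (inj hij).app W ≫ k = f i hij) → k = cdesc j W f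

/-- The component at `W` of the evident natural transformation `S_{<j} ⟶ S`. -/
def injLt {S : C ⥤ C} {J : Type w} {r : J → J → Prop} {D : Decomp S J}
    (L : LtDecomp r D) (j : J) (W : C) : (L.functor j).obj W ⟶ S.obj W :=
  L.cdesc j W (fun i _ => (D.inj i).app W)

/-- The free extension `inj*_{<j} : S*_{<j} A ⟶ S* A` of the unit. -/
def injStar {S : C ⥤ C} {J : Type w} {r : J → J → Prop} {D : Decomp S J}
    (L : LtDecomp r D) (F : ∀ X : C, FreeAlg S X)
    (Flt : ∀ (j : J) (X : C), FreeAlg (L.functor j) X) (j : J) (A : C) :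
    (Flt j A).carrier ⟶ (F A).carrier :=
  (Flt j A).desc (injLt L j ((F A).carrier) ≫ (F A).act) ((F A).emb)

/-- The morphism `e_{j,A} = [inj*_{<j}, ι_A ∘ inj_j ∘ S_j inj*_{<j}] :
S*_{<j} A + S_j S*_{<j} A ⟶ S* A`. -/
noncomputable def eMor {S : C ⥤ C} {J : Type w} {r : J → J → Prop} {D : Decomp S J}
    (L : LtDecomp r D) (F : ∀ X : C, FreeAlg S X)
    (Flt : ∀ (j : J) (X : C), FreeAlg (L.functor j) X) (j : J) (A : C) :
    ((Flt j A).carrier ⨿ (D.part j).obj ((Flt j A).carrier)) ⟶ (F A).carrier :=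
  coprod.desc (injStar L F Flt j A)
    ((D.part j).map (injStar L F Flt j A) ≫ (D.inj j).app ((F A).carrier) ≫ (F A).act)

/-- A relatively flat higher-order GSOS law: a `J`-indexed family
`ρ^j_{X,Y} : S_j(X × B(X,Y)) ⟶ B(X, S*_{<j}(X+Y) + S_j S*_{<j}(X+Y))`
dinatural in `X` and natural in `Y`. -/
structure RelFlatLaw (S : C ⥤ C) (B : Cᵒᵖ × C ⥤ C) {J : Type w} {r : J → J → Prop}
    (D : Decomp S J) (L : LtDecomp r D)
    (Flt : ∀ (j : J) (X : C), FreeAlg (L.functor j) X) where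
  app : ∀ (j : J) (X Y : C),
    (D.part j).obj (X ⨯ B.obj (op X, Y)) ⟶
      B.obj (op X, (Flt j (X ⨿ Y)).carrier ⨿ (D.part j).obj ((Flt j (X ⨿ Y)).carrier))
  dinatural : ∀ (j : J) {X X' Y : C} (f : X ⟶ X'),
    (D.part j).map (prod.map f (𝟙 (B.obj (op X', Y)))) ≫ app j X' Y ≫
        B.map ((f.op, 𝟙 _) :
          (op X', (Flt j (X' ⨿ Y)).carrier ⨿ (D.part j).obj ((Flt j (X' ⨿ Y)).carrier)) ⟶
          (op X, (Flt j (X' ⨿ Y)).carrier ⨿ (D.part j).obj ((Flt j (X' ⨿ Y)).carrier)))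
      = (D.part j).map (prod.map (𝟙 X) (B.map ((f.op, 𝟙 Y) : (op X', Y) ⟶ (op X, Y)))) ≫
        app j X Y ≫
        B.map ((𝟙 (op X),
            coprod.map (freeMap (fun X => Flt j X) (coprod.map f (𝟙 Y)))
              ((D.part j).map (freeMap (fun X => Flt j X) (coprod.map f (𝟙 Y))))) :
          (op X, (Flt j (X ⨿ Y)).carrier ⨿ (D.part j).obj ((Flt j (X ⨿ Y)).carrier)) ⟶
          (op X, (Flt j (X' ⨿ Y)).carrier ⨿ (D.part j).obj ((Flt j (X' ⨿ Y)).carrier)))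
  natural : ∀ (j : J) {X Y Y' : C} (g : Y ⟶ Y'),
    (D.part j).map (prod.map (𝟙 X) (B.map ((𝟙 (op X), g) : (op X, Y) ⟶ (op X, Y')))) ≫
        app j X Y'
      = app j X Y ≫
        B.map ((𝟙 (op X),
            coprod.map (freeMap (fun X => Flt j X) (coprod.map (𝟙 X) g))
              ((D.part j).map (freeMap (fun X => Flt j X) (coprod.map (𝟙 X) g)))) :
          (op X, (Flt j (X ⨿ Y)).carrier ⨿ (D.part j).obj ((Flt j (X ⨿ Y)).carrier)) ⟶
          (op X, (Flt j (X ⨿ Y')).carrier ⨿ (D.part j).obj ((Flt j (X ⨿ Y')).carrier)))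

/-- The higher-order GSOS law (components) induced by a relatively flat law. -/
noncomputable def inducedLaw {S : C ⥤ C} {B : Cᵒᵖ × C ⥤ C} {J : Type w} {r : J → J → Prop}
    {D : Decomp S J} {L : LtDecomp r D} {Flt : ∀ (j : J) (X : C), FreeAlg (L.functor j) X}
    (F : ∀ X : C, FreeAlg S X) (ρ : RelFlatLaw S B D L Flt) (X Y : C) :
    S.obj (X ⨯ B.obj (op X, Y)) ⟶ B.obj (op X, (F (X ⨿ Y)).carrier) :=
  D.cdesc _ (fun j => ρ.app j X Y ≫
    B.map ((𝟙 (op X), eMor L F Flt j (X ⨿ Y)) :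
      (op X, (Flt j (X ⨿ Y)).carrier ⨿ (D.part j).obj ((Flt j (X ⨿ Y)).carrier)) ⟶
      (op X, (F (X ⨿ Y)).carrier)))

/-- `(X, a, c)` is a `ρ`-bialgebra for the law with components `ρ`. -/
def IsBialgebra (S : C ⥤ C) (B : Cᵒᵖ × C ⥤ C) (F : ∀ X : C, FreeAlg S X)
    (ρ : ∀ X Y : C, S.obj (X ⨯ B.obj (op X, Y)) ⟶ B.obj (op X, (F (X ⨿ Y)).carrier))
    (X : C) (a : S.obj X ⟶ X) (c : X ⟶ B.obj (op X, X)) : Prop :=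
  a ≫ c = S.map (prod.lift (𝟙 X) c) ≫ ρ X X ≫
    B.map ((𝟙 (op X), (F (X ⨿ X)).desc a (coprod.desc (𝟙 X) (𝟙 X))) :
      (op X, (F (X ⨿ X)).carrier) ⟶ (op X, X))

/-- A locally final coalgebra: a higher-order `B`-coalgebra `z : Z ⟶ B(Z,Z)` that is a
final coalgebra for the endofunctor `B(Z,−)`. -/
def IsLocallyFinal (B : Cᵒᵖ × C ⥤ C) (Z : C) (z : Z ⟶ B.obj (op Z, Z)) : Prop :=
  ∀ (X : C) (c : X ⟶ B.obj (op Z, X)),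
    ∃! h : X ⟶ Z, h ≫ z = c ≫ B.map ((𝟙 (op Z), h) : (op Z, X) ⟶ (op Z, Z))


/-- An initial `S`-algebra `μS`. -/
structure InitAlg {C' : Type u} [Category.{v} C'] (S : C' ⥤ C') where
  carrier : C'
  str : S.obj carrier ⟶ carrier
  fold : ∀ {A : C'}, (S.obj A ⟶ A) → (carrier ⟶ A)
  fold_comm : ∀ {A : C'} (a : S.obj A ⟶ A), str ≫ fold a = S.map (fold a) ≫ a
  fold_unique : ∀ {A : C'} (a : S.obj A ⟶ A) (k : carrier ⟶ A),
    str ≫ k = S.map k ≫ a → k = fold a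

section Adequacy

section Category

variable {E : Type u} [Category.{v} E]

/-- Functoriality of `B` in its covariant argument. -/
theorem map_snd_comp (B : Eᵒᵖ × E ⥤ E) (X : E) {Y Y' Y'' : E} (f : Y ⟶ Y') (g : Y' ⟶ Y'') :
    B.map ((𝟙 (op X), f) : (op X, Y) ⟶ (op X, Y')) ≫
        B.map ((𝟙 (op X), g) : (op X, Y') ⟶ (op X, Y'')) =
      B.map ((𝟙 (op X), f ≫ g) : (op X, Y) ⟶ (op X, Y'')) := by
  rw [← B.map_comp, prod_comp, Category.comp_id]

/-- The two actions of the bifunctor `B` commute. -/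
theorem map_snd_map_fst (B : Eᵒᵖ × E ⥤ E) {X X' Y Y' : E} (f : X ⟶ X') (g : Y ⟶ Y') :
    B.map ((𝟙 (op X'), g) : (op X', Y) ⟶ (op X', Y')) ≫
        B.map ((f.op, 𝟙 Y') : (op X', Y') ⟶ (op X, Y')) =
      B.map ((f.op, 𝟙 Y) : (op X', Y) ⟶ (op X, Y)) ≫
        B.map ((𝟙 (op X), g) : (op X, Y) ⟶ (op X, Y')) := by
  rw [← B.map_comp, ← B.map_comp, prod_comp, prod_comp, Category.comp_id, Category.comp_id,
    Category.id_comp, Category.id_comp]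

/-- Free extensions are stable under postcomposition with algebra morphisms. -/
theorem FreeAlg.desc_comp {S : E ⥤ E} {X A A' : E} (F : FreeAlg S X) (a : S.obj A ⟶ A)
    (a' : S.obj A' ⟶ A') (h : X ⟶ A) (k : A ⟶ A') (hk : a ≫ k = S.map k ≫ a') :
    F.desc a h ≫ k = F.desc a' (h ≫ k) := by
  apply F.desc_unique
  · rw [← Category.assoc, F.emb_desc]
  · rw [← Category.assoc, F.act_desc, Category.assoc, hk, S.map_comp, Category.assoc]

theorem freeMap_desc {S : E ⥤ E} (F : ∀ X : E, FreeAlg S X) {X Y A : E} (f : X ⟶ Y)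
    (a : S.obj A ⟶ A) (h : Y ⟶ A) :
    freeMap F f ≫ (F Y).desc a h = (F X).desc a (f ≫ h) := by
  rw [freeMap, (F X).desc_comp _ a _ _ ((F Y).act_desc a h), Category.assoc, (F Y).emb_desc]

theorem Decomp.hom_ext {S : E ⥤ E} {J : Type w} (D : Decomp S J) {W T : E}
    {f g : S.obj W ⟶ T} (h : ∀ j, (D.inj j).app W ≫ f = (D.inj j).app W ≫ g) : f = g :=
  (D.cdesc_unique W (fun j => (D.inj j).app W ≫ g) f h).trans
    (D.cdesc_unique W _ g fun _ => rfl).symm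

section Parts

variable {S : E ⥤ E} {J : Type w} {r : J → J → Prop} {D : Decomp S J} (L : LtDecomp r D)

theorem LtDecomp.hom_ext {j : J} {W T : E} {f g : (L.functor j).obj W ⟶ T}
    (h : ∀ (i : J) (hij : r i j), (L.inj hij).app W ≫ f = (L.inj hij).app W ≫ g) : f = g :=
  (L.cdesc_unique j W (fun _ hij => (L.inj hij).app W ≫ g) f h).trans
    (L.cdesc_unique j W _ g fun _ _ => rfl).symm

theorem inj_injLt {i j : J} (hij : r i j) (W : E) :
    (L.inj hij).app W ≫ injLt L j W = (D.inj i).app W :=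
  L.inj_cdesc j W _ i hij

theorem injLt_naturality (j : J) {W W' : E} (f : W ⟶ W') :
    (L.functor j).map f ≫ injLt L j W' = injLt L j W ≫ S.map f := by
  apply L.hom_ext
  intro i hij
  rw [← Category.assoc, ← NatTrans.naturality, Category.assoc, inj_injLt, ← Category.assoc,
    inj_injLt, NatTrans.naturality]

theorem injStar_desc (F : ∀ X : E, FreeAlg S X)
    (Flt : ∀ (j : J) (X : E), FreeAlg (L.functor j) X) (j : J) {X A : E}
    (a : S.obj A ⟶ A) (h : X ⟶ A) :
    injStar L F Flt j X ≫ (F X).desc a h = (Flt j X).desc (injLt L j A ≫ a) h := by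
  rw [injStar, (Flt j X).desc_comp _ (injLt L j A ≫ a), (F X).emb_desc]
  rw [Category.assoc, (F X).act_desc, ← Category.assoc, ← injLt_naturality, Category.assoc]

end Parts

end Category

section Parts

variable {S : C ⥤ C} {J : Type w} {r : J → J → Prop} {D : Decomp S J} (L : LtDecomp r D)
  (F : ∀ X : C, FreeAlg S X) (Flt : ∀ (j : J) (X : C), FreeAlg (L.functor j) X)

/-- Evaluating the terms in the image of `eMor` in an `S`-algebra. -/
theorem eMor_desc (j : J) {X A : C} (a : S.obj A ⟶ A) (h : X ⟶ A) :
    eMor L F Flt j X ≫ (F X).desc a h =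
      coprod.desc ((Flt j X).desc (injLt L j A ≫ a) h)
        ((D.part j).map ((Flt j X).desc (injLt L j A ≫ a) h) ≫ (D.inj j).app A ≫ a) := by
  rw [eMor, coprod.desc_comp, injStar_desc, Category.assoc, Category.assoc, (F X).act_desc,
    ← injStar_desc L F, Functor.map_comp, Category.assoc]
  simp only [NatTrans.naturality_assoc]

theorem eMor_naturality (j : J) {X Y : C} (f : X ⟶ Y) :
    coprod.map (freeMap (fun X => Flt j X) f) ((D.part j).map (freeMap (fun X => Flt j X) f)) ≫
        eMor L F Flt j Y = eMor L F Flt j X ≫ freeMap F f := by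
  have h : freeMap (fun X => Flt j X) f ≫ injStar L F Flt j Y =
      (Flt j X).desc (injLt L j _ ≫ (F Y).act) (f ≫ (F Y).emb) :=
    freeMap_desc (fun X => Flt j X) f _ _
  change _ = _ ≫ (F X).desc (F Y).act (f ≫ (F Y).emb)
  rw [eMor_desc, ← h, eMor, coprod.map_desc, Functor.map_comp, Category.assoc]

end Parts

section Law

variable {S : C ⥤ C} {B : Cᵒᵖ × C ⥤ C} {J : Type w} {r : J → J → Prop}
  {D : Decomp S J} {L : LtDecomp r D} {Flt : ∀ (j : J) (X : C), FreeAlg (L.functor j) X}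
  (F : ∀ X : C, FreeAlg S X) (ρ : RelFlatLaw S B D L Flt)

theorem inj_inducedLaw (j : J) (X Y : C) :
    (D.inj j).app _ ≫ inducedLaw F ρ X Y = ρ.app j X Y ≫
      B.map ((𝟙 (op X), eMor L F Flt j (X ⨿ Y)) :
        (op X, (Flt j (X ⨿ Y)).carrier ⨿ (D.part j).obj ((Flt j (X ⨿ Y)).carrier)) ⟶
        (op X, (F (X ⨿ Y)).carrier)) :=
  D.inj_cdesc _ _ j

theorem inducedLaw_natural {X Y Y' : C} (g : Y ⟶ Y') :
    S.map (prod.map (𝟙 X) (B.map ((𝟙 (op X), g) : (op X, Y) ⟶ (op X, Y')))) ≫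
        inducedLaw F ρ X Y' =
      inducedLaw F ρ X Y ≫ B.map ((𝟙 (op X), freeMap F (coprod.map (𝟙 X) g)) :
        (op X, (F (X ⨿ Y)).carrier) ⟶ (op X, (F (X ⨿ Y')).carrier)) := by
  apply D.hom_ext
  intro j
  rw [← NatTrans.naturality_assoc, inj_inducedLaw, ← Category.assoc, ρ.natural, Category.assoc,
    map_snd_comp, eMor_naturality, ← Category.assoc, inj_inducedLaw, Category.assoc, map_snd_comp]

theorem inducedLaw_dinatural {X X' Y : C} (f : X ⟶ X') :
    S.map (prod.map f (𝟙 (B.obj (op X', Y)))) ≫ inducedLaw F ρ X' Y ≫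
        B.map ((f.op, 𝟙 _) : (op X', (F (X' ⨿ Y)).carrier) ⟶ (op X, (F (X' ⨿ Y)).carrier)) =
      S.map (prod.map (𝟙 X) (B.map ((f.op, 𝟙 Y) : (op X', Y) ⟶ (op X, Y)))) ≫
        inducedLaw F ρ X Y ≫ B.map ((𝟙 (op X), freeMap F (coprod.map f (𝟙 Y))) :
          (op X, (F (X ⨿ Y)).carrier) ⟶ (op X, (F (X' ⨿ Y)).carrier)) := by
  apply D.hom_ext
  intro j
  rw [← NatTrans.naturality_assoc, ← NatTrans.naturality_assoc, ← Category.assoc ((D.inj j).app _),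
    ← Category.assoc ((D.inj j).app _), inj_inducedLaw, inj_inducedLaw, Category.assoc,
    Category.assoc, map_snd_map_fst, map_snd_comp, ← eMor_naturality, ← map_snd_comp]
  have h := ρ.dinatural j (Y := Y) f
  simp only [← Category.assoc] at h ⊢
  rw [h]

variable {F}

/-- The bialgebra condition for the induced law can be checked on the summands of `S`. -/
theorem isBialgebra_inducedLaw {X : C} {a : S.obj X ⟶ X} {c : X ⟶ B.obj (op X, X)}
    (h : ∀ j, ((D.inj j).app X ≫ a) ≫ c = (D.part j).map (prod.lift (𝟙 X) c) ≫ ρ.app j X X ≫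
      B.map ((𝟙 (op X), coprod.desc
          ((Flt j (X ⨿ X)).desc (injLt L j X ≫ a) (coprod.desc (𝟙 X) (𝟙 X)))
          ((D.part j).map ((Flt j (X ⨿ X)).desc (injLt L j X ≫ a) (coprod.desc (𝟙 X) (𝟙 X))) ≫
            (D.inj j).app X ≫ a)) :
        (op X, (Flt j (X ⨿ X)).carrier ⨿ (D.part j).obj ((Flt j (X ⨿ X)).carrier)) ⟶
        (op X, X))) :
    IsBialgebra S B F (inducedLaw F ρ) X a c := by
  apply D.hom_ext
  intro j
  rw [← Category.assoc, h, ← NatTrans.naturality_assoc, ← Category.assoc ((D.inj j).app _),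
    inj_inducedLaw, Category.assoc, map_snd_comp, eMor_desc]

/-- A morphism from the initial algebra of an operational model to a bialgebra is a
(higher-order) coalgebra morphism. -/
theorem fold_coalgebra_morphism (μ : InitAlg S)
    {γ : μ.carrier ⟶ B.obj (op μ.carrier, μ.carrier)}
    (hγ : IsBialgebra S B F (inducedLaw F ρ) μ.carrier μ.str γ)
    {X : C} {a : S.obj X ⟶ X} {c : X ⟶ B.obj (op X, X)}
    (hX : IsBialgebra S B F (inducedLaw F ρ) X a c) :
    γ ≫ B.map ((𝟙 (op μ.carrier), μ.fold a) :
        (op μ.carrier, μ.carrier) ⟶ (op μ.carrier, X)) =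
      μ.fold a ≫ c ≫ B.map (((μ.fold a).op, 𝟙 X) : (op X, X) ⟶ (op μ.carrier, X)) := by
  set f := μ.fold a
  have hfa : μ.str ≫ f = S.map f ≫ a := μ.fold_comm a
  let step : S.obj (μ.carrier ⨯ B.obj (op μ.carrier, X)) ⟶ B.obj (op μ.carrier, X) :=
    inducedLaw F ρ μ.carrier X ≫
      B.map ((𝟙 (op μ.carrier), (F (μ.carrier ⨿ X)).desc a (coprod.desc f (𝟙 X))) :
        (op μ.carrier, (F (μ.carrier ⨿ X)).carrier) ⟶ (op μ.carrier, X))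
  have recursion_unique (k : μ.carrier ⟶ B.obj (op μ.carrier, X))
      (hk : μ.str ≫ k = S.map (prod.lift (𝟙 _) k) ≫ step) :
      prod.lift (𝟙 _) k = μ.fold (prod.lift (S.map prod.fst ≫ μ.str) step) := by
    apply μ.fold_unique
    apply Limits.prod.hom_ext
    · simp only [Category.assoc, prod.lift_fst, Category.comp_id]
      rw [← S.map_comp_assoc, prod.lift_fst, S.map_id, Category.id_comp]
    · simp only [Category.assoc, prod.lift_snd]
      exact hk
  have h₁ := recursion_unique
    (γ ≫ B.map ((𝟙 (op μ.carrier), f) : (op μ.carrier, μ.carrier) ⟶ (op μ.carrier, X))) <| by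
      have hlift : prod.lift (𝟙 μ.carrier)
          (γ ≫ B.map ((𝟙 (op μ.carrier), f) : (op μ.carrier, μ.carrier) ⟶ (op μ.carrier, X))) =
          prod.lift (𝟙 _) γ ≫ prod.map (𝟙 _)
            (B.map ((𝟙 (op μ.carrier), f) : (op μ.carrier, μ.carrier) ⟶ (op μ.carrier, X))) := by
        rw [prod.lift_map, Category.comp_id]
      rw [hlift, S.map_comp, Category.assoc, ← Category.assoc (S.map (prod.map _ _)),
        inducedLaw_natural, Category.assoc, map_snd_comp, freeMap_desc, coprod.map_desc,
        ← Category.assoc, hγ, Category.assoc, Category.assoc, map_snd_comp,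
        FreeAlg.desc_comp _ _ a _ _ hfa, coprod.desc_comp, Category.comp_id, Category.id_comp]
  have h₂ := recursion_unique
    (f ≫ c ≫ B.map ((f.op, 𝟙 X) : (op X, X) ⟶ (op μ.carrier, X))) <| by
      have hlift : prod.lift (𝟙 μ.carrier)
          (f ≫ c ≫ B.map ((f.op, 𝟙 X) : (op X, X) ⟶ (op μ.carrier, X))) =
          prod.lift (𝟙 _) (f ≫ c) ≫ prod.map (𝟙 _)
            (B.map ((f.op, 𝟙 X) : (op X, X) ⟶ (op μ.carrier, X))) := by
        rw [prod.lift_map, Category.comp_id, Category.assoc]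
      have hlift' : f ≫ prod.lift (𝟙 X) c = prod.lift (𝟙 _) (f ≫ c) ≫ prod.map f (𝟙 _) := by
        rw [prod.lift_map, prod.comp_lift, Category.comp_id, Category.id_comp, Category.comp_id]
      have hdesc : (F (μ.carrier ⨿ X)).desc a (coprod.desc f (𝟙 X)) =
          freeMap F (coprod.map f (𝟙 X)) ≫ (F (X ⨿ X)).desc a (coprod.desc (𝟙 X) (𝟙 X)) := by
        rw [freeMap_desc, coprod.map_desc, Category.comp_id, Category.comp_id]
      have hdin := inducedLaw_dinatural F ρ (Y := X) f
      rw [← Category.assoc, hfa, Category.assoc, ← Category.assoc a, hX, Category.assoc,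
        Category.assoc, map_snd_map_fst, ← S.map_comp_assoc, hlift', hlift, S.map_comp,
        S.map_comp, Category.assoc, Category.assoc]
      simp only [step]
      rw [hdesc, ← map_snd_comp]
      have hdin' := congrArg (· ≫ B.map ((𝟙 (op μ.carrier),
        (F (X ⨿ X)).desc a (coprod.desc (𝟙 X) (𝟙 X))) :
          (op μ.carrier, (F (X ⨿ X)).carrier) ⟶ (op μ.carrier, X))) hdin
      simp only [Category.assoc] at hdin'
      rw [hdin']
  simpa only [prod.lift_snd] using congrArg (· ≫ prod.snd) (h₁.trans h₂.symm)

end Law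

/-- Guarded recursion into a locally final coalgebra, with direct access to its points. -/
theorem IsLocallyFinal.exists_corec {B : Cᵒᵖ × C ⥤ C} {Z : C} {z : Z ⟶ B.obj (op Z, Z)}
    (hz : IsLocallyFinal B Z z) {X : C} (c : X ⟶ B.obj (op Z, Z ⨿ X)) :
    ∃ k : X ⟶ Z, k ≫ z = c ≫ B.map ((𝟙 (op Z), coprod.desc (𝟙 Z) k) :
      (op Z, Z ⨿ X) ⟶ (op Z, Z)) := by
  obtain ⟨h, hh, -⟩ := hz (Z ⨿ X) (coprod.desc
    (z ≫ B.map ((𝟙 (op Z), coprod.inl) : (op Z, Z) ⟶ (op Z, Z ⨿ X))) c)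
  have hinl : coprod.inl ≫ h = 𝟙 Z := by
    refine (hz Z z).unique ?_ ?_
    · rw [Category.assoc, hh, coprod.inl_desc_assoc, Category.assoc, map_snd_comp]
    · rw [Category.id_comp]
      exact (Category.comp_id z).symm.trans (congrArg (z ≫ ·) (B.map_id (op Z, Z)).symm)
  have hdesc : coprod.desc (𝟙 Z) (coprod.inr ≫ h) = h := by
    apply coprod.hom_ext
    · rw [coprod.inl_desc, hinl]
    · rw [coprod.inr_desc]
  refine ⟨coprod.inr ≫ h, ?_⟩
  rw [hdesc, Category.assoc, hh, coprod.inr_desc_assoc]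

/-- A relatively flat law over a well-founded relation extends a locally final coalgebra to a
bialgebra. -/
theorem IsLocallyFinal.exists_isBialgebra {S : C ⥤ C} {B : Cᵒᵖ × C ⥤ C} {J : Type w}
    {r : J → J → Prop} {D : Decomp S J} {L : LtDecomp r D}
    {Flt : ∀ (j : J) (X : C), FreeAlg (L.functor j) X} (F : ∀ X : C, FreeAlg S X)
    (hwf : WellFounded r) (ρ : RelFlatLaw S B D L Flt) {Z : C} {z : Z ⟶ B.obj (op Z, Z)}
    (hz : IsLocallyFinal B Z z) :
    ∃ a : S.obj Z ⟶ Z, IsBialgebra S B F (inducedLaw F ρ) Z a z := by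
  let ev (j : J) (b : (L.functor j).obj Z ⟶ Z) : (Flt j (Z ⨿ Z)).carrier ⟶ Z :=
    (Flt j (Z ⨿ Z)).desc b (coprod.desc (𝟙 Z) (𝟙 Z))
  have step (j : J) (b : (L.functor j).obj Z ⟶ Z) := hz.exists_corec
    ((D.part j).map (prod.lift (𝟙 Z) z) ≫ ρ.app j Z Z ≫
      B.map ((𝟙 (op Z), coprod.map (ev j b) ((D.part j).map (ev j b))) :
        (op Z, (Flt j (Z ⨿ Z)).carrier ⨿ (D.part j).obj ((Flt j (Z ⨿ Z)).carrier)) ⟶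
        (op Z, Z ⨿ (D.part j).obj Z)))
  choose next hnext using step
  let part : ∀ j, (D.part j).obj Z ⟶ Z := hwf.fix fun j ih => next j (L.cdesc j Z ih)
  have hpart (j : J) : part j = next j (L.cdesc j Z fun i _ => part i) := hwf.fix_eq _ j
  refine ⟨D.cdesc Z part, isBialgebra_inducedLaw ρ fun j => ?_⟩
  have hlt : injLt L j Z ≫ D.cdesc Z part = L.cdesc j Z fun i _ => part i := by
    apply L.cdesc_unique
    intro i hij
    rw [← Category.assoc, inj_injLt, D.inj_cdesc]
  rw [hlt, D.inj_cdesc, hpart, hnext, ← hpart, Category.assoc, Category.assoc, map_snd_comp,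
    coprod.map_desc, Category.comp_id]

end Adequacy

/-- Let `ρ` be induced by a relatively flat higher-order GSOS law, let
`z : Z ⟶ B(Z,Z)` be a locally final coalgebra, and assume `B(μΣ,−)` has a final
coalgebra. Then `Z` carries a `Σ`-algebra structure `a_ρ` making `(Z, a_ρ, z)` a
`ρ`-bialgebra, and `(Z, a_ρ)` is computationally adequate. -/
theorem locally_final_coalgebra_adequate
    (S : C ⥤ C) (B : Cᵒᵖ × C ⥤ C) (F : ∀ X : C, FreeAlg S X)
    {J : Type w} {r : J → J → Prop} (hwf : WellFounded r)
    (D : Decomp S J) (L : LtDecomp r D)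
    (Flt : ∀ (j : J) (X : C), FreeAlg (L.functor j) X)
    (Fj : ∀ (j : J) (X : C), FreeAlg (D.part j) X)
    (ρ : RelFlatLaw S B D L Flt)
    -- a locally final coalgebra (Z, z)
    (Z : C) (z : Z ⟶ B.obj (op Z, Z)) (hz : IsLocallyFinal B Z z)
    -- the initial algebra and the operational model γ of the induced law ρ
    (μ : InitAlg S)
    (γ : μ.carrier ⟶ B.obj (op μ.carrier, μ.carrier))
    (hγ : μ.str ≫ γ = S.map (prod.lift (𝟙 μ.carrier) γ) ≫
      inducedLaw F ρ μ.carrier μ.carrier ≫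
      B.map ((𝟙 (op μ.carrier),
          (F (μ.carrier ⨿ μ.carrier)).desc μ.str (coprod.desc (𝟙 μ.carrier) (𝟙 μ.carrier))) :
        (op μ.carrier, (F (μ.carrier ⨿ μ.carrier)).carrier) ⟶ (op μ.carrier, μ.carrier)))
    -- a final coalgebra (ν, ζ) for the endofunctor B(μΣ, −)
    (ν : C) (ζ : ν ⟶ B.obj (op μ.carrier, ν))
    (hν : ∀ (A : C) (c : A ⟶ B.obj (op μ.carrier, A)),
      ∃! h : A ⟶ ν, h ≫ ζ = c ≫ B.map ((𝟙 (op μ.carrier), h) :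
        (op μ.carrier, A) ⟶ (op μ.carrier, ν)))
    -- beh : μΣ ⟶ ν, the unique B(μΣ,−)-coalgebra morphism from (μΣ, γ)
    (beh : μ.carrier ⟶ ν)
    (hbeh : beh ≫ ζ = γ ≫ B.map ((𝟙 (op μ.carrier), beh) :
      (op μ.carrier, μ.carrier) ⟶ (op μ.carrier, ν))) :
    ∃ a : S.obj Z ⟶ Z,
      IsBialgebra S B F (inducedLaw F ρ) Z a z ∧
      ∃ m : Z ⟶ ν, beh = μ.fold a ≫ m := by
  obtain ⟨a, ha⟩ := hz.exists_isBialgebra F hwf ρ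
  refine ⟨a, ha, ?_⟩
  have hcoalg := fold_coalgebra_morphism ρ μ hγ ha
  obtain ⟨m, hm, -⟩ := hν Z
    (z ≫ B.map (((μ.fold a).op, 𝟙 Z) : (op Z, Z) ⟶ (op μ.carrier, Z)))
  refine ⟨m, (hν _ γ).unique hbeh ?_⟩
  rw [Category.assoc, hm, ← map_snd_comp, ← Category.assoc γ, hcoalg]
  simp only [Category.assoc]
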